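/- There exists a γ-invariant set Θ₀ ⊆ Θ of full m-measure, not depending on β, such that for every β < β₁^m and every θ ∈ Θ₀: the fibre of the global attractor satisfies 𝒜_β(θ) = {0}, and lim_{n→∞} f^n_{β,θ}(v) = 0 for all v ∈ ℝ². -/

import Mathlib

open Filter MeasureTheory Metric Set
open scoped Topology

noncomputable section

/-- ℝ² with the Euclidean norm. -/
abbrev R2 : Type := EuclideanSpace ℝ (Fin 2)

/-- Action of a 2×2 real matrix on Euclidean ℝ². -/
def mulVecE (M : Matrix (Fin 2) (Fin 2) ℝ) (v : R2) : R2 :=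
  (WithLp.equiv 2 (Fin 2 → ℝ)).symm (M.mulVec ((WithLp.equiv 2 (Fin 2 → ℝ)) v))

/-- Operator norm of a 2×2 real matrix induced by the Euclidean norm on ℝ². -/
def opNorm (M : Matrix (Fin 2) (Fin 2) ℝ) : ℝ :=
  ‖(Matrix.toEuclideanCLM (𝕜 := ℝ) M : R2 →L[ℝ] R2)‖

/-- The cocycle `A_n(θ) = A(γ^{n-1}θ) ⋯ A(θ)`. -/
def coc {Θ : Type*} (γ : Θ → Θ) (A : Θ → Matrix (Fin 2) (Fin 2) ℝ) :
    ℕ → Θ → Matrix (Fin 2) (Fin 2) ℝ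
  | 0, _ => 1
  | n + 1, θ => coc γ A n (γ θ) * A θ

/-- Maximal Lyapunov exponent `λ_max(A) = sup_θ limsup (1/n) log‖A_n(θ)‖`. -/
def lyapMax {Θ : Type*} (γ : Θ → Θ) (A : Θ → Matrix (Fin 2) (Fin 2) ℝ) : ℝ :=
  ⨆ θ : Θ, Filter.limsup (fun n : ℕ => Real.log (opNorm (coc γ A n θ)) / n) Filter.atTop

/-- The hypotheses on `h`: C² on [0,∞), strictly increasing, strictly concave, bounded,
nonnegative, `h 0 = 0`, `h' 0 = 1`. -/
def GoodH (h : ℝ → ℝ) : Prop :=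
  ContDiffOn ℝ 2 h (Set.Ici 0) ∧ StrictMonoOn h (Set.Ici 0) ∧
    StrictConcaveOn ℝ (Set.Ici 0) h ∧ BddAbove (h '' Set.Ici 0) ∧
    (∀ x ∈ Set.Ici (0 : ℝ), 0 ≤ h x) ∧ h 0 = 0 ∧ derivWithin h (Set.Ici 0) 0 = 1

/-- The scaling condition `sup_{x ≥ 0} h(x) ≤ (sup_θ ‖A(θ)‖)⁻¹`. -/
def Scaled {Θ : Type*} (A : Θ → Matrix (Fin 2) (Fin 2) ℝ) (h : ℝ → ℝ) : Prop :=
  ∀ x ∈ Set.Ici (0 : ℝ), h x ≤ (⨆ θ : Θ, opNorm (A θ))⁻¹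

open scoped Classical in
/-- The fibre maps `f_{β,θ}(v) = h(β‖v‖)·A(θ)·v/‖v‖`, `f_{β,θ}(0) = 0`. -/
def fibMap {Θ : Type*} (A : Θ → Matrix (Fin 2) (Fin 2) ℝ) (h : ℝ → ℝ) (β : ℝ)
    (θ : Θ) (v : R2) : R2 :=
  if v = 0 then 0 else (h (β * ‖v‖) / ‖v‖) • mulVecE (A θ) v

/-- The skew product `f_β(θ,v) = (γθ, f_{β,θ}(v))`. -/
def skewProd {Θ : Type*} (γ : Θ → Θ) (A : Θ → Matrix (Fin 2) (Fin 2) ℝ) (h : ℝ → ℝ)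
    (β : ℝ) : Θ × R2 → Θ × R2 :=
  fun p => (γ p.1, fibMap A h β p.1 p.2)

/-- The global attractor `𝒜_β = ⋂_{n∈ℕ} f_β^n(Θ × B̄₁(0))`. -/
def globalAttractor {Θ : Type*} (γ : Θ → Θ) (A : Θ → Matrix (Fin 2) (Fin 2) ℝ)
    (h : ℝ → ℝ) (β : ℝ) : Set (Θ × R2) :=
  ⋂ n : ℕ, (skewProd γ A h β)^[n] '' (Set.univ ×ˢ Metric.closedBall (0 : R2) 1)

/-- The fibre `𝒜_β(θ) = {x : (θ,x) ∈ 𝒜_β}` of the global attractor. -/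
def attractorFib {Θ : Type*} (γ : Θ → Θ) (A : Θ → Matrix (Fin 2) (Fin 2) ℝ)
    (h : ℝ → ℝ) (β : ℝ) (θ : Θ) : Set R2 :=
  {x : R2 | (θ, x) ∈ globalAttractor γ A h β}

/-- `v(α) = (cos 2πα, sin 2πα)ᵗ`. -/
def vFull (α : ℝ) : R2 :=
  (WithLp.equiv 2 (Fin 2 → ℝ)).symm ![Real.cos (2 * Real.pi * α), Real.sin (2 * Real.pi * α)]

/-- `(cos πα, sin πα)ᵗ`, representing the projective point `α ∈ 𝕋 ≅ ℝP¹`. -/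
def vHalf (α : ℝ) : R2 :=
  (WithLp.equiv 2 (Fin 2 → ℝ)).symm ![Real.cos (Real.pi * α), Real.sin (Real.pi * α)]

/-- The projective angle coordinate `p(w) = (1/π)·arg(w) mod 1 ∈ [0,1)` of a nonzero
vector `w ∈ ℝ²`; for `w ≠ 0` this equals `(1/π)·arctan(w₂/w₁) mod 1`. -/
def projAngle (w : R2) : ℝ :=
  Int.fract (Complex.arg (Complex.ofReal (w 0) + Complex.ofReal (w 1) * Complex.I) / Real.pi)

/-- The projective action `g(θ,α) = (γθ, g_θ(α))` of the cocycle on `Θ × 𝕋`,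
where `𝕋` is modelled by the fundamental domain `[0,1) ⊆ ℝ`. -/
def gMap {Θ : Type*} (γ : Θ → Θ) (A : Θ → Matrix (Fin 2) (Fin 2) ℝ) :
    Θ × ℝ → Θ × ℝ :=
  fun p => (γ p.1, projAngle (mulVecE (A p.1) (vHalf p.2)))

/-- `Ω(θ,α) = ‖A(θ)(cos πα, sin πα)ᵗ‖`. -/
def Omega {Θ : Type*} (A : Θ → Matrix (Fin 2) (Fin 2) ℝ) (p : Θ × ℝ) : ℝ :=
  ‖mulVecE (A p.1) (vHalf p.2)‖

/-- The fibre maps `F_{β,θ,α}(r) = h(βr)·Ω(θ,α)` of the double skew product. -/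
def dsFib {Θ : Type*} (A : Θ → Matrix (Fin 2) (Fin 2) ℝ) (h : ℝ → ℝ) (β : ℝ)
    (p : Θ × ℝ) (r : ℝ) : ℝ :=
  h (β * r) * Omega A p

/-- The double skew product `F_β(θ,α,r) = (g(θ,α), h(βr)·Ω(θ,α))` on `Θ × 𝕋 × [0,∞)`. -/
def dsMap {Θ : Type*} (γ : Θ → Θ) (A : Θ → Matrix (Fin 2) (Fin 2) ℝ) (h : ℝ → ℝ)
    (β : ℝ) : Θ × ℝ × ℝ → Θ × ℝ × ℝ :=
  fun p => ((gMap γ A (p.1, p.2.1)).1, (gMap γ A (p.1, p.2.1)).2, dsFib A h β (p.1, p.2.1) p.2.2)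

/-- `Ω_n(θ,α) = ∏_{i=0}^{n-1} Ω(g^i(θ,α))`. -/
def OmegaProd {Θ : Type*} (γ : Θ → Θ) (A : Θ → Matrix (Fin 2) (Fin 2) ℝ) (n : ℕ)
    (p : Θ × ℝ) : ℝ :=
  ∏ i ∈ Finset.range n, Omega A ((gMap γ A)^[i] p)

/-- `Γ(a,b) = inf_{a ≤ x ≤ 1} inf_{0 < q ≤ b} h(qx)/(q·h(x))`. -/
def GammaH (h : ℝ → ℝ) (a b : ℝ) : ℝ :=
  sInf {y : ℝ | ∃ x ∈ Set.Icc a 1, ∃ q ∈ Set.Ioc (0 : ℝ) b, y = h (q * x) / (q * h x)}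

/-- The inverse `g⁻¹(θ,α) = (γ⁻¹θ, projective angle of A(γ⁻¹θ)⁻¹·v(α))` of the
projective action. -/
def gInv {Θ : Type*} (γinv : Θ → Θ) (A : Θ → Matrix (Fin 2) (Fin 2) ℝ) :
    Θ × ℝ → Θ × ℝ :=
  fun p => (γinv p.1, projAngle (mulVecE (A (γinv p.1))⁻¹ (vHalf p.2)))

/-- `F^n_{β,g^{-n}(θ,α)}(1)`, the pullback iterate defining the upper bounding graph. -/
def pullback1 {Θ : Type*} (γ : Θ → Θ) (γinv : Θ → Θ) (A : Θ → Matrix (Fin 2) (Fin 2) ℝ)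
    (h : ℝ → ℝ) (β : ℝ) (n : ℕ) (p : Θ × ℝ) : ℝ :=
  ((dsMap γ A h β)^[n] (((gInv γinv A)^[n] p).1, ((gInv γinv A)^[n] p).2, 1)).2.2

/-- The running maximum of `0` and the Birkhoff sums of `φ` up to time `n`. -/
def birkhoffMax {Θ : Type*} (T : Θ → Θ) (φ : Θ → ℝ) : ℕ → Θ → ℝ
  | 0, _ => 0
  | n + 1, x => max 0 (φ x + birkhoffMax T φ n (T x))

section BirkhoffMax

variable {Θ : Type*} {T : Θ → Θ} {φ : Θ → ℝ}

lemma birkhoffMax_nonneg (n : ℕ) (x : Θ) : 0 ≤ birkhoffMax T φ n x := by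
  cases n with
  | zero => exact le_rfl
  | succ n => exact le_max_left _ _

lemma birkhoffMax_mono (x : Θ) : Monotone fun n => birkhoffMax T φ n x := by
  refine monotone_nat_of_le_succ fun n => ?_
  induction n generalizing x with
  | zero => exact birkhoffMax_nonneg _ _
  | succ n ih => exact max_le_max le_rfl (add_le_add le_rfl (ih (T x)))

lemma birkhoffSum_le_birkhoffMax (n : ℕ) (x : Θ) :
    birkhoffSum T φ n x ≤ birkhoffMax T φ n x := by
  induction n generalizing x with
  | zero => simp [birkhoffMax]
  | succ n ih =>
    rw [birkhoffSum_succ']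
    exact (add_le_add le_rfl (ih (T x))).trans (le_max_right _ _)

lemma birkhoffMax_le {c : ℝ} (hc : ∀ x, |φ x| ≤ c) (n : ℕ) (x : Θ) :
    birkhoffMax T φ n x ≤ n * c := by
  have hc0 : 0 ≤ c := (abs_nonneg _).trans (hc x)
  induction n generalizing x with
  | zero => simp [birkhoffMax]
  | succ n ih =>
    refine max_le (by positivity) ?_
    have := ih (T x)
    have := (le_abs_self _).trans (hc x)
    push_cast
    linarith

lemma abs_birkhoffMax_succ_sub_le (n : ℕ) (x : Θ) :
    |birkhoffMax T φ (n + 1) x - birkhoffMax T φ n (T x)| ≤ |φ x| := by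
  have h0 := birkhoffMax_nonneg (T := T) (φ := φ) n (T x)
  have h1 := le_abs_self (φ x)
  have h2 := neg_abs_le (φ x)
  rw [birkhoffMax, abs_le]
  constructor
  · have := le_max_right 0 (φ x + birkhoffMax T φ n (T x))
    linarith
  · have : max 0 (φ x + birkhoffMax T φ n (T x)) ≤ |φ x| + birkhoffMax T φ n (T x) :=
      max_le (by positivity) (by linarith)
    linarith

lemma exists_birkhoffMax_le_iff (x : Θ) :
    (∃ C : ℕ, ∀ n, birkhoffMax T φ n (T x) ≤ C) ↔ ∃ C : ℕ, ∀ n, birkhoffMax T φ n x ≤ C := by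
  constructor
  · rintro ⟨C, hC⟩
    obtain ⟨D, hD⟩ := exists_nat_ge (|φ x| + C)
    refine ⟨D, fun n => ?_⟩
    cases n with
    | zero => exact Nat.cast_nonneg D
    | succ n =>
      have := hC n
      have := le_abs_self (φ x)
      exact max_le (Nat.cast_nonneg D) (by linarith)
  · rintro ⟨C, hC⟩
    obtain ⟨D, hD⟩ := exists_nat_ge (|φ x| + C)
    refine ⟨D, fun n => ?_⟩
    have h1 := hC (n + 1)
    have h2 : φ x + birkhoffMax T φ n (T x) ≤ birkhoffMax T φ (n + 1) x := le_max_right _ _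
    have := neg_abs_le (φ x)
    linarith

lemma measurable_birkhoffMax [MeasurableSpace Θ] (hT : Measurable T) (hφ : Measurable φ)
    (n : ℕ) : Measurable (birkhoffMax T φ n) := by
  induction n with
  | zero => exact measurable_const
  | succ n ih => exact measurable_const.max (hφ.add (ih.comp hT))

end BirkhoffMax

/-- For an ergodic transformation, the Birkhoff sums of a bounded function of negative integral
are almost everywhere bounded above. -/
theorem Ergodic.ae_exists_birkhoffSum_le {Θ : Type*} [MeasurableSpace Θ] {m : Measure Θ}
    [IsProbabilityMeasure m] {T : Θ → Θ} (hT : Ergodic T m) {φ : Θ → ℝ} (hφ : Measurable φ)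
    {c : ℝ} (hc : ∀ x, |φ x| ≤ c) (hneg : ∫ x, φ x ∂m < 0) :
    ∀ᵐ x ∂m, ∃ C : ℝ, ∀ n, birkhoffSum T φ n x ≤ C := by
  have hMmeas := measurable_birkhoffMax hT.measurable hφ
  set E : Set Θ := {x | ∃ C : ℕ, ∀ n, birkhoffMax T φ n x ≤ C} with hE
  have hEm : MeasurableSet E := by
    have : E = ⋃ C : ℕ, ⋂ n, {x | birkhoffMax T φ n x ≤ C} := by ext; simp [hE]
    rw [this]
    exact .iUnion fun C => .iInter fun n => measurableSet_le (hMmeas n) measurable_const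
  have hEinv : T ⁻¹' E = E := by
    ext x
    exact exists_birkhoffMax_le_iff x
  rcases hT.toPreErgodic.ae_mem_or_ae_notMem hEm hEinv with h | h
  · filter_upwards [h] with x ⟨C, hC⟩
    exact ⟨C, fun n => (birkhoffSum_le_birkhoffMax n x).trans (hC n)⟩
  exfalso
  have hint : ∀ n, Integrable (birkhoffMax T φ n) m := fun n =>
    .of_bound (hMmeas n).aestronglyMeasurable (n * c) (ae_of_all _ fun x => by
      rw [Real.norm_of_nonneg (birkhoffMax_nonneg n x)]
      exact birkhoffMax_le hc n x)
  have hφint : Integrable φ m := .of_bound hφ.aestronglyMeasurable c (ae_of_all _ hc)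
  have hlim : Tendsto
      (fun n => ∫ x, (birkhoffMax T φ (n + 1) x - birkhoffMax T φ n (T x)) ∂m) atTop
      (𝓝 (∫ x, φ x ∂m)) := by
    refine tendsto_integral_of_dominated_convergence (fun x => |φ x|)
      (fun n => ((hMmeas (n + 1)).sub
        ((hMmeas n).comp hT.measurable)).aestronglyMeasurable) hφint.abs
      (fun n => ae_of_all _ fun x => abs_birkhoffMax_succ_sub_le n x) ?_
    filter_upwards [h] with x hx
    have hx' : ¬ ∃ C : ℕ, ∀ n, birkhoffMax T φ n (T x) ≤ C := fun h' =>
      hx ((exists_birkhoffMax_le_iff x).1 h')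
    push Not at hx'
    obtain ⟨D, hD⟩ := exists_nat_ge (|φ x|)
    obtain ⟨N, hN⟩ := hx' D
    refine tendsto_const_nhds.congr' ?_
    filter_upwards [eventually_ge_atTop N] with n hn
    have h1 := birkhoffMax_mono (T := T) (φ := φ) (T x) hn
    have h2 := neg_abs_le (φ x)
    simp only at h1
    rw [birkhoffMax, max_eq_right (by linarith)]
    ring
  refine absurd (ge_of_tendsto' hlim fun n => ?_) (not_le.2 hneg)
  have hcomp : ∫ x, birkhoffMax T φ n (T x) ∂m = ∫ x, birkhoffMax T φ n x ∂m := by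
    conv_rhs => rw [← hT.map_eq]
    exact (integral_map hT.measurable.aemeasurable
      (hMmeas n).aestronglyMeasurable).symm
  have hintT : Integrable (fun x => birkhoffMax T φ n (T x)) m :=
    hT.toMeasurePreserving.integrable_comp_of_integrable (hint n)
  rw [integral_sub (hint _) hintT, hcomp, sub_nonneg]
  exact integral_mono (hint n) (hint (n + 1)) fun x => birkhoffMax_mono x n.le_succ

/-- A subadditive sequence is controlled by the Birkhoff sums of any of its terms. -/
lemma mul_le_birkhoffSum_of_subadditive {Θ : Type*} {T : Θ → Θ} {a : ℕ → Θ → ℝ} {c : ℝ}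
    (hc : ∀ n x, a n x ≤ n * c) (hsub : ∀ n k x, a (n + k) x ≤ a n x + a k (T^[n] x))
    (k n : ℕ) (x : Θ) : k * a (n + k) x ≤ 2 * k * (k * |c|) + birkhoffSum T (a k) n x := by
  have hck : ∀ j ≤ k, ∀ y, a j y ≤ k * |c| := fun j hj y =>
    calc a j y ≤ j * c := hc j y
      _ ≤ j * |c| := by gcongr; exact le_abs_self c
      _ ≤ k * |c| := by gcongr
  have hwindow : ∀ n, ∑ j ∈ Finset.range k, a (n + j) x ≤
      k * (k * |c|) + birkhoffSum T (a k) n x := by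
    intro n
    induction n with
    | zero =>
      rw [birkhoffSum_zero, add_zero]
      refine (Finset.sum_le_card_nsmul _ _ (k * |c|) fun j hj => ?_).trans (by simp)
      rw [zero_add]
      exact hck j (Finset.mem_range.1 hj).le x
    | succ n ih =>
      have h1 := Finset.sum_range_succ (fun j => a (n + j) x) k
      have h2 := Finset.sum_range_succ' (fun j => a (n + j) x) k
      have h3 := hsub n k x
      have h4 : ∑ j ∈ Finset.range k, a (n + 1 + j) x =
          ∑ j ∈ Finset.range k, a (n + (j + 1)) x :=
        Finset.sum_congr rfl fun j _ => by rw [add_assoc, add_comm 1 j]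
      rw [birkhoffSum_succ, h4]
      simp only [add_zero] at h2
      linarith
  have hlast : k * a (n + k) x ≤ ∑ j ∈ Finset.range k, (a (n + j) x + k * |c|) := by
    refine le_trans (by simp) (Finset.card_nsmul_le_sum (Finset.range k) _ (a (n + k) x)
      fun j hj => ?_)
    have hj' := (Finset.mem_range.1 hj).le
    have h1 := hsub (n + j) (k - j) x
    rw [show n + j + (k - j) = n + k by omega] at h1
    have h2 := hck (k - j) (Nat.sub_le _ _) (T^[n + j] x)
    linarith
  rw [Finset.sum_add_distrib] at hlast
  have := hwindow n
  simp only [Finset.sum_const, Finset.card_range, nsmul_eq_mul] at hlast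
  linarith

/-- The upper half of the subadditive ergodic theorem, for linearly bounded sequences. -/
theorem Ergodic.ae_exists_subadditive_le {Θ : Type*} [MeasurableSpace Θ] {m : Measure Θ}
    [IsProbabilityMeasure m] {T : Θ → Θ} (hT : Ergodic T m) {a : ℕ → Θ → ℝ}
    (ha : ∀ n, Measurable (a n)) (h0 : ∀ n x, 0 ≤ a n x) {c : ℝ} (hc : ∀ n x, a n x ≤ n * c)
    (hsub : ∀ n k x, a (n + k) x ≤ a n x + a k (T^[n] x)) {l s : ℝ}
    (hl : Tendsto (fun n : ℕ => (∫ x, a n x ∂m) / n) atTop (𝓝 l)) (hs : l < s) :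
    ∀ᵐ x ∂m, ∃ C : ℝ, ∀ n : ℕ, a n x ≤ n * s + C := by
  obtain ⟨k, hks, hk⟩ := ((hl.eventually_lt_const hs).and (eventually_gt_atTop 0)).exists
  have hk' : (0 : ℝ) < k := by exact_mod_cast hk
  rw [div_lt_iff₀ hk'] at hks
  have hs0 : 0 < s := by
    have : 0 ≤ ∫ x, a k x ∂m := integral_nonneg (h0 k)
    exact pos_of_mul_pos_left (this.trans_lt hks) hk'.le
  have hint : Integrable (a k) m := .of_bound (ha k).aestronglyMeasurable (k * c)
    (ae_of_all _ fun x => by rw [Real.norm_of_nonneg (h0 k x)]; exact hc k x)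
  have hbdd := hT.ae_exists_birkhoffSum_le (φ := fun x => a k x - s * k) ((ha k).sub_const _)
    (c := k * c + s * k)
    (fun x => by
      have := h0 k x
      have := hc k x
      have : 0 < s * k := by positivity
      rw [abs_le]
      constructor <;> linarith)
    (by
      rw [integral_sub hint (integrable_const _)]
      simpa using hks)
  filter_upwards [hbdd] with x ⟨C, hC⟩
  refine ⟨(2 * k * (k * |c|) + |C|) / k + k * |c|, fun n => ?_⟩
  have hpos : 0 ≤ (2 * k * (k * |c|) + |C|) / k := by positivity
  rcases lt_or_ge n k with hn | hn
  · have h1 : (n : ℝ) * c ≤ n * |c| := by gcongr; exact le_abs_self c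
    have h2 : (n : ℝ) * |c| ≤ k * |c| := by gcongr
    have h3 : 0 ≤ n * s := by positivity
    have := hc n x
    linarith
  · obtain ⟨n, rfl⟩ := Nat.exists_eq_add_of_le' hn
    have h1 := mul_le_birkhoffSum_of_subadditive hc hsub k n x
    have h2 := hC n
    have h3 : birkhoffSum T (fun x => a k x - s * k) n x =
        birkhoffSum T (a k) n x - n * (s * k) := by
      simp [birkhoffSum, Finset.sum_sub_distrib]
    have h4 := le_abs_self C
    have h5 : a (n + k) x ≤ (2 * k * (k * |c|) + |C|) / k + n * s := by
      rw [div_add' _ _ _ hk'.ne', le_div_iff₀ hk']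
      linarith
    have h6 : 0 ≤ k * s := by positivity
    have h7 : 0 ≤ k * |c| := by positivity
    push_cast
    linarith

/-- An almost sure property holds on a measurable strictly invariant set of full measure. -/
lemma exists_measurableSet_invariant_of_ae {Θ : Type*} [MeasurableSpace Θ] {m : Measure Θ}
    [IsProbabilityMeasure m] {e : Θ ≃ᵐ Θ} (he : MeasurePreserving e m m) {P : Θ → Prop}
    (hP : ∀ᵐ x ∂m, P x) :
    ∃ S : Set Θ, MeasurableSet S ∧ e ⁻¹' S = S ∧ m S = 1 ∧ ∀ x ∈ S, P x := by
  obtain ⟨N, hPN, hNm, hN⟩ := exists_measurable_superset_of_null (ae_iff.1 hP)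
  have hiter : ∀ n : ℕ, MeasurePreserving e^[n] m m := he.iterate
  have hiter' : ∀ n : ℕ, MeasurePreserving e.symm^[n] m m := he.symm.iterate
  have hSm : MeasurableSet {x | ∀ n : ℕ, e^[n] x ∉ N ∧ e.symm^[n] x ∉ N} := by
    simp only [ofPred_forall, ofPred_and]
    exact .iInter fun n => ((hiter n).measurable hNm.compl).inter ((hiter' n).measurable hNm.compl)
  refine ⟨{x | ∀ n : ℕ, e^[n] x ∉ N ∧ e.symm^[n] x ∉ N}, hSm, ?_, ?_, fun x hx => ?_⟩
  · ext x
    simp only [mem_preimage, mem_ofPred_eq]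
    constructor
    · intro hx n
      refine ⟨?_, by simpa [Function.iterate_succ_apply] using (hx (n + 1)).2⟩
      cases n with
      | zero => simpa using (hx 1).2
      | succ n => exact (hx n).1
    · intro hx n
      refine ⟨(hx (n + 1)).1, ?_⟩
      cases n with
      | zero => exact (hx 1).1
      | succ n => simpa [Function.iterate_succ_apply] using (hx n).2
  · refine (mem_ae_iff_prob_eq_one hSm).1 (ae_all_iff.2 fun n => ?_)
    have hN' : ∀ᵐ x ∂m, x ∉ N := measure_eq_zero_iff_ae_notMem.1 hN
    exact ((hiter n).quasiMeasurePreserving.ae hN').and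
      ((hiter' n).quasiMeasurePreserving.ae hN')
  · by_contra h
    exact (hx 0).1 (hPN h)

lemma opNorm_mul_le (M N : Matrix (Fin 2) (Fin 2) ℝ) : opNorm (M * N) ≤ opNorm M * opNorm N := by
  unfold opNorm
  rw [map_mul]
  exact norm_mul_le _ _

lemma opNorm_one : opNorm 1 = 1 := by
  unfold opNorm
  rw [map_one]
  exact norm_one

lemma norm_mulVecE_le (M : Matrix (Fin 2) (Fin 2) ℝ) (v : R2) :
    ‖mulVecE M v‖ ≤ opNorm M * ‖v‖ :=
  (Matrix.toEuclideanCLM (𝕜 := ℝ) M : R2 →L[ℝ] R2).le_opNorm v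

lemma one_le_opNorm_of_det_eq_one {M : Matrix (Fin 2) (Fin 2) ℝ} (hM : M.det = 1) :
    1 ≤ opNorm M := by
  have hcol : ∀ j, M 0 j ^ 2 + M 1 j ^ 2 ≤ opNorm M ^ 2 := fun j => by
    have h := norm_mulVecE_le M (EuclideanSpace.single j 1)
    have h' := pow_le_pow_left₀ (norm_nonneg _) h 2
    rw [EuclideanSpace.norm_sq_eq] at h'
    simpa [mulVecE, Fin.sum_univ_two] using h'
  rw [Matrix.det_fin_two] at hM
  have h0 := hcol 0
  have h1 := hcol 1
  have hn : 0 ≤ opNorm M := norm_nonneg _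
  nlinarith [sq_nonneg (M 0 0 - M 1 1), sq_nonneg (M 0 1 + M 1 0)]

lemma measurable_opNorm {Θ : Type*} [MeasurableSpace Θ] {B : Θ → Matrix (Fin 2) (Fin 2) ℝ}
    (hB : ∀ i j, Measurable fun θ => B θ i j) : Measurable fun θ => opNorm (B θ) := by
  have hcont : Continuous fun M : Fin 2 → Fin 2 → ℝ => opNorm (Matrix.of M) := by
    let L : Matrix (Fin 2) (Fin 2) ℝ →ₗ[ℝ] (R2 →L[ℝ] R2) :=
      (Matrix.toEuclideanCLM (n := Fin 2) (𝕜 := ℝ)).toAlgEquiv.toLinearMap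
    exact (L.continuous_of_finiteDimensional).norm
  have hmeas : Measurable fun θ => (fun i j => B θ i j : Fin 2 → Fin 2 → ℝ) :=
    measurable_pi_lambda _ fun i => measurable_pi_lambda _ fun j => hB i j
  exact hcont.measurable.comp hmeas

section Cocycle

variable {Θ : Type*} {γ : Θ → Θ} {A : Θ → Matrix (Fin 2) (Fin 2) ℝ}

lemma coc_add (n k : ℕ) (θ : Θ) : coc γ A (n + k) θ = coc γ A k (γ^[n] θ) * coc γ A n θ := by
  induction n generalizing θ with
  | zero => simp [coc]
  | succ n ih =>
    rw [show n + 1 + k = n + k + 1 by ring, coc, ih, coc, Function.iterate_succ_apply, mul_assoc]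

lemma det_coc (hdet : ∀ θ, (A θ).det = 1) (n : ℕ) (θ : Θ) : (coc γ A n θ).det = 1 := by
  induction n generalizing θ with
  | zero => simp [coc]
  | succ n ih => rw [coc, Matrix.det_mul, ih, hdet, one_mul]

lemma measurable_coc [MeasurableSpace Θ] (hγ : Measurable γ)
    (hA : ∀ i j, Measurable fun θ => A θ i j) (n : ℕ) (i j : Fin 2) :
    Measurable fun θ => coc γ A n θ i j := by
  induction n generalizing i j with
  | zero => exact measurable_const
  | succ n ih =>
    simp only [coc, Matrix.mul_apply]
    exact Finset.measurable_sum _ fun l _ => ((ih i l).comp hγ).mul (hA l j)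

lemma log_opNorm_coc_nonneg (hdet : ∀ θ, (A θ).det = 1) (n : ℕ) (θ : Θ) :
    0 ≤ Real.log (opNorm (coc γ A n θ)) :=
  Real.log_nonneg (one_le_opNorm_of_det_eq_one (det_coc hdet n θ))

lemma log_opNorm_mul_le {M N : Matrix (Fin 2) (Fin 2) ℝ} (hM : M.det = 1) (hN : N.det = 1) :
    Real.log (opNorm (M * N)) ≤ Real.log (opNorm M) + Real.log (opNorm N) := by
  have h1 := one_le_opNorm_of_det_eq_one hM
  have h2 := one_le_opNorm_of_det_eq_one hN
  have h3 := one_le_opNorm_of_det_eq_one (M := M * N) (by rw [Matrix.det_mul, hM, hN, one_mul])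
  rw [← Real.log_mul (by linarith) (by linarith)]
  exact Real.log_le_log (by linarith) (opNorm_mul_le M N)

lemma log_opNorm_coc_add_le (hdet : ∀ θ, (A θ).det = 1) (n k : ℕ) (θ : Θ) :
    Real.log (opNorm (coc γ A (n + k) θ)) ≤
      Real.log (opNorm (coc γ A n θ)) + Real.log (opNorm (coc γ A k (γ^[n] θ))) := by
  rw [coc_add, add_comm]
  exact log_opNorm_mul_le (det_coc hdet _ _) (det_coc hdet _ _)

lemma log_opNorm_coc_le (hdet : ∀ θ, (A θ).det = 1) {C : ℝ} (hC : ∀ θ, opNorm (A θ) ≤ C)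
    (n : ℕ) (θ : Θ) : Real.log (opNorm (coc γ A n θ)) ≤ n * Real.log C := by
  induction n generalizing θ with
  | zero => simp [coc, opNorm_one]
  | succ n ih =>
    have h1 := log_opNorm_mul_le (det_coc (γ := γ) hdet n (γ θ)) (hdet θ)
    have h2 := ih (γ θ)
    have h3 := Real.log_le_log
      (zero_lt_one.trans_le (one_le_opNorm_of_det_eq_one (hdet θ))) (hC θ)
    rw [coc]
    push_cast
    linarith

end Cocycle

lemma GoodH.le_self {h : ℝ → ℝ} (hh : GoodH h) {x : ℝ} (hx : 0 ≤ x) : h x ≤ x := by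
  obtain ⟨hC2, -, hconc, -, -, h0, h1⟩ := hh
  rcases hx.eq_or_lt with rfl | hx
  · exact h0.le
  have := hconc.concaveOn.slope_le_derivWithin (x := 0) (y := x) self_mem_Ici hx.le hx
    (hC2.differentiableOn (by norm_num) 0 self_mem_Ici)
  rwa [h1, slope_def_field, h0, sub_zero, sub_zero, div_le_one hx] at this

section SkewProduct

variable {Θ : Type*} {γ : Θ → Θ} {A : Θ → Matrix (Fin 2) (Fin 2) ℝ} {h : ℝ → ℝ} {β : ℝ}

lemma exists_fibMap_eq_smul (hh : GoodH h) (hβ : 0 ≤ β) (θ : Θ) (v : R2) :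
    ∃ c : ℝ, 0 ≤ c ∧ c ≤ β ∧ fibMap A h β θ v = c • mulVecE (A θ) v := by
  by_cases hv : v = 0
  · exact ⟨0, le_rfl, hβ, by simp [fibMap, hv]⟩
  have hv' : 0 < ‖v‖ := norm_pos_iff.2 hv
  have hx : 0 ≤ β * ‖v‖ := by positivity
  refine ⟨h (β * ‖v‖) / ‖v‖, div_nonneg (hh.2.2.2.2.1 _ hx) hv'.le, ?_, by simp [fibMap, hv]⟩
  rw [div_le_iff₀ hv']
  exact hh.le_self hx

lemma mulVecE_smul (M : Matrix (Fin 2) (Fin 2) ℝ) (c : ℝ) (v : R2) :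
    mulVecE M (c • v) = c • mulVecE M v :=
  (Matrix.toEuclideanCLM (𝕜 := ℝ) M : R2 →L[ℝ] R2).map_smul c v

lemma mulVecE_mulVecE (M N : Matrix (Fin 2) (Fin 2) ℝ) (v : R2) :
    mulVecE M (mulVecE N v) = mulVecE (M * N) v := by
  exact congrArg (WithLp.equiv 2 (Fin 2 → ℝ)).symm (Matrix.mulVec_mulVec _ M N)

lemma skewProd_iterate_fst (n : ℕ) (p : Θ × R2) :
    ((skewProd γ A h β)^[n] p).1 = γ^[n] p.1 := by
  induction n generalizing p with
  | zero => rfl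
  | succ n ih => rw [Function.iterate_succ_apply, ih, Function.iterate_succ_apply]; rfl

lemma exists_skewProd_iterate_eq_smul (hh : GoodH h) (hβ : 0 ≤ β) (n : ℕ) (θ : Θ) (v : R2) :
    ∃ c : ℝ, 0 ≤ c ∧ c ≤ β ^ n ∧
      ((skewProd γ A h β)^[n] (θ, v)).2 = c • mulVecE (coc γ A n θ) v := by
  induction n generalizing θ v with
  | zero => exact ⟨1, zero_le_one, by simp, by simp [coc, mulVecE]⟩
  | succ n ih =>
    obtain ⟨c, hc0, hcβ, hc⟩ := exists_fibMap_eq_smul (A := A) hh hβ θ v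
    obtain ⟨d, hd0, hdβ, hd⟩ := ih (γ θ) (fibMap A h β θ v)
    refine ⟨d * c, mul_nonneg hd0 hc0, ?_, ?_⟩
    · rw [pow_succ]
      exact mul_le_mul hdβ hcβ hc0 (pow_nonneg hβ n)
    · rw [Function.iterate_succ_apply, skewProd, hd, hc, mulVecE_smul, mulVecE_mulVecE, coc,
        smul_smul]

lemma norm_skewProd_iterate_le (hh : GoodH h) (hβ : 0 ≤ β) (n : ℕ) (θ : Θ) (v : R2) :
    ‖((skewProd γ A h β)^[n] (θ, v)).2‖ ≤ β ^ n * opNorm (coc γ A n θ) * ‖v‖ := by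
  obtain ⟨c, hc0, hcβ, hc⟩ := exists_skewProd_iterate_eq_smul (γ := γ) (A := A) hh hβ n θ v
  rw [hc, norm_smul, Real.norm_of_nonneg hc0, mul_assoc]
  exact mul_le_mul hcβ (norm_mulVecE_le _ _) (norm_nonneg _) (pow_nonneg hβ n)

lemma zero_mem_attractorFib (hγ : Function.Surjective γ) (θ : Θ) :
    (0 : R2) ∈ attractorFib γ A h β θ := by
  refine mem_iInter.2 fun n => ?_
  obtain ⟨θ', rfl⟩ := hγ.iterate n θ
  refine ⟨(θ', 0), ⟨mem_univ _, by simp⟩, Prod.ext (skewProd_iterate_fst n _) ?_⟩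
  have hfix : ∀ n θ, ((skewProd γ A h β)^[n] (θ, 0)).2 = 0 := fun n => by
    induction n with
    | zero => exact fun _ => rfl
    | succ n ih =>
      intro θ
      rw [Function.iterate_succ_apply, skewProd, fibMap, if_pos rfl, ih]
  exact hfix n θ'

end SkewProduct

lemma tendsto_pow_mul_of_log_le {u : ℕ → ℝ} {β s C : ℝ} (hu : ∀ n, 0 < u n) (hβ : 0 < β)
    (hs : s < -Real.log β) (hC : ∀ n : ℕ, Real.log (u n) ≤ n * s + C) :
    Tendsto (fun n => β ^ n * u n) atTop (𝓝 0) := by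
  have hlim : Tendsto (fun n : ℕ => Real.exp C * Real.exp (Real.log β + s) ^ n) atTop
      (𝓝 0) := by
    simpa using (tendsto_pow_atTop_nhds_zero_of_lt_one (Real.exp_pos _).le
      (Real.exp_lt_one_iff.2 (by linarith : Real.log β + s < 0))).const_mul (Real.exp C)
  refine squeeze_zero (fun n => by have := hu n; positivity) (fun n => ?_) hlim
  have h1 : u n ≤ Real.exp (n * s + C) := (Real.log_le_iff_le_exp (hu n)).1 (hC n)
  calc β ^ n * u n ≤ β ^ n * Real.exp (n * s + C) := by gcongr
    _ = Real.exp C * Real.exp (Real.log β + s) ^ n := by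
      rw [Real.exp_add (Real.log β), Real.exp_log hβ, mul_pow, Real.exp_add, ← Real.exp_nat_mul]
      ring

/-- There is a γ-invariant full-measure set `Θ₀` (independent of β) such
that for all `β < β₁^m = e^{-λ_m(A)}` and `θ ∈ Θ₀`: `𝒜_β(θ) = {0}` and all forward
orbits in the fibre tend to 0. -/
theorem stmt3 {Θ : Type*} [MeasurableSpace Θ]
    (γ : Θ ≃ Θ) (hγ : Measurable ⇑γ) (hγ' : Measurable ⇑γ.symm)
    (m : Measure Θ) [IsProbabilityMeasure m] (herg : Ergodic ⇑γ m)
    (A : Θ → Matrix (Fin 2) (Fin 2) ℝ) (hdet : ∀ θ, (A θ).det = 1)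
    (hAmeas : ∀ i j, Measurable fun θ => A θ i j) (hAbdd : ∃ C : ℝ, ∀ θ, opNorm (A θ) ≤ C)
    (h : ℝ → ℝ) (hh : GoodH h) (hscale : Scaled A h)
    (lam : ℝ)
    (hlam : Filter.Tendsto
      (fun n : ℕ => (∫ θ, Real.log (opNorm (coc ⇑γ A n θ)) ∂m) / n)
      Filter.atTop (𝓝 lam)) :
    ∃ Θ₀ : Set Θ, MeasurableSet Θ₀ ∧ ⇑γ ⁻¹' Θ₀ = Θ₀ ∧ m Θ₀ = 1 ∧
      ∀ β : ℝ, 0 < β → β < Real.exp (-lam) → ∀ θ ∈ Θ₀,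
        attractorFib ⇑γ A h β θ = {0} ∧
        ∀ v : R2,
          Filter.Tendsto (fun n : ℕ => ((skewProd ⇑γ A h β)^[n] (θ, v)).2)
            Filter.atTop (𝓝 0) := by
  obtain ⟨C, hC⟩ := hAbdd
  set e : Θ ≃ᵐ Θ := ⟨γ, hγ, hγ'⟩
  have herg' : Ergodic ⇑e m := herg
  have hsymm : Ergodic ⇑γ.symm m := herg'.symm
  set a : ℕ → Θ → ℝ := fun n θ => Real.log (opNorm (coc γ A n θ)) with ha
  set b : ℕ → Θ → ℝ := fun n θ => a n (γ.symm^[n] θ) with hb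
  have ham : ∀ n, Measurable (a n) := fun n =>
    (measurable_opNorm (measurable_coc hγ hAmeas n)).log
  have hbm : ∀ n, Measurable (b n) := fun n => (ham n).comp (hγ'.iterate n)
  have hblam : Tendsto (fun n : ℕ => (∫ θ, b n θ ∂m) / n) atTop (𝓝 lam) := by
    refine hlam.congr fun n => ?_
    have hmp := hsymm.toMeasurePreserving.iterate n
    congr 1
    conv_lhs => rw [← hmp.map_eq]
    exact integral_map hmp.measurable.aemeasurable (ham n).aestronglyMeasurable
  have hbsub : ∀ n k θ, b (n + k) θ ≤ b n θ + b k (γ.symm^[n] θ) := fun n k θ => by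
    have hcancel : γ^[k] (γ.symm^[n + k] θ) = γ.symm^[n] θ := by
      rw [add_comm n k, Function.iterate_add_apply]
      exact γ.rightInverse_symm.iterate k _
    have h1 := log_opNorm_coc_add_le (γ := γ) hdet k n (γ.symm^[n + k] θ)
    rw [hcancel, add_comm k n] at h1
    have h2 : γ.symm^[k] (γ.symm^[n] θ) = γ.symm^[n + k] θ := by
      rw [add_comm n k, Function.iterate_add_apply]
    simp only [hb, ha, h2]
    linarith
  have hrate : ∀ j : ℕ, lam < lam + 1 / ((j : ℝ) + 1) := fun j => by
    have : 0 < 1 / ((j : ℝ) + 1) := by positivity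
    linarith
  have hgood : ∀ᵐ θ ∂m, ∀ j : ℕ,
      (∃ D : ℝ, ∀ n : ℕ, a n θ ≤ n * (lam + 1 / ((j : ℝ) + 1)) + D) ∧
        ∃ D : ℝ, ∀ n : ℕ, b n θ ≤ n * (lam + 1 / ((j : ℝ) + 1)) + D :=
    ae_all_iff.2 fun j =>
      (herg.ae_exists_subadditive_le ham (log_opNorm_coc_nonneg hdet)
        (log_opNorm_coc_le hdet hC) (log_opNorm_coc_add_le hdet) hlam (hrate j)).and
      (hsymm.ae_exists_subadditive_le hbm (fun n _ => log_opNorm_coc_nonneg hdet n _)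
        (fun n _ => log_opNorm_coc_le hdet hC n _) hbsub hblam (hrate j))
  obtain ⟨S, hSm, hSinv, hS1, hSgood⟩ :=
    exists_measurableSet_invariant_of_ae herg'.toMeasurePreserving hgood
  refine ⟨S, hSm, hSinv, hS1, fun β hβ hβlam θ hθ => ?_⟩
  obtain ⟨j, hj⟩ : ∃ j : ℕ, 1 / ((j : ℝ) + 1) < -Real.log β - lam :=
    exists_nat_one_div_lt (by
      have := (Real.log_lt_iff_lt_exp hβ).2 hβlam
      linarith)
  obtain ⟨⟨D, hD⟩, ⟨D', hD'⟩⟩ := hSgood θ hθ j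
  have hpos : ∀ n θ, 0 < opNorm (coc γ A n θ) := fun n θ =>
    zero_lt_one.trans_le (one_le_opNorm_of_det_eq_one (det_coc hdet n θ))
  have hfwd := tendsto_pow_mul_of_log_le (fun n => hpos n θ) hβ (by linarith) hD
  have hbwd := tendsto_pow_mul_of_log_le (fun n => hpos n (γ.symm^[n] θ)) hβ (by linarith) hD'
  constructor
  · refine Subset.antisymm (fun x hx => ?_)
      (singleton_subset_iff.2 (zero_mem_attractorFib γ.surjective θ))
    refine norm_le_zero_iff.1 (ge_of_tendsto' hbwd fun n => ?_)
    obtain ⟨⟨θ', w⟩, ⟨-, hw⟩, hpw⟩ := mem_iInter.1 hx n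
    have hθ' : γ.symm^[n] θ = θ' := by
      have h1 := skewProd_iterate_fst (γ := γ) (A := A) (h := h) (β := β) n (θ', w)
      rw [hpw] at h1
      simp only at h1
      rw [h1]
      exact γ.leftInverse_symm.iterate n θ'
    have hle := norm_skewProd_iterate_le (γ := γ) (A := A) hh hβ.le n θ' w
    rw [hpw] at hle
    rw [hθ']
    refine hle.trans (mul_le_of_le_one_right ?_ (mem_closedBall_zero_iff.1 hw))
    exact mul_nonneg (pow_nonneg hβ.le n) (hpos n θ').le
  · intro v
    refine squeeze_zero_norm (norm_skewProd_iterate_le hh hβ.le · θ v) ?_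
    simpa using hfwd.mul_const ‖v‖
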